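/- arXiv:math-ph/0507072 — 2 statements merged into one kernel-verified Lean document; each statement's English description precedes it below -/
import Mathlib

section
/- (Lemma 2.) For all integers n₁, n₂, m₁, m₂ with n₁ + n₂τ' ∈ (0,1] and m₁ + m₂τ' ∈ (0,1], at least one of the following holds: (n₁ + n₂τ') + τ'(m₁ + m₂τ') ∈ (0,1], or (n₁ + n₂τ') + (τ')²(m₁ + m₂τ') ∈ (0,1]. That is, for n, m ∈ Σ((0,1]), either n + τm ∈ Σ((0,1]) or n + τ²m ∈ Σ((0,1]). -/
noncomputable def tau : ℝ := (1 + Real.sqrt 5) / 2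
noncomputable def tau' : ℝ := (1 - Real.sqrt 5) / 2

lemma tau'_neg : tau' < 0 := by
  have h : (1 : ℝ) < Real.sqrt 5 := Real.lt_sqrt_of_sq_lt (by norm_num)
  unfold tau'
  linarith

lemma tau'_sq : tau' ^ 2 = tau' + 1 := by
  have h : Real.sqrt 5 ^ 2 = 5 := Real.sq_sqrt (by norm_num)
  unfold tau'
  linarith

/-- Lemma 2: for n, m ∈ Σ((0,1]), either n + τm ∈ Σ((0,1]) or n + τ²m ∈ Σ((0,1])
(stated on Galois conjugates). -/
theorem stmt10_graded_addition_dichotomy (n₁ n₂ m₁ m₂ : ℤ)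
    (hn : (n₁ : ℝ) + n₂ * tau' ∈ Set.Ioc 0 1)
    (hm : (m₁ : ℝ) + m₂ * tau' ∈ Set.Ioc 0 1) :
    ((n₁ : ℝ) + n₂ * tau') + tau' * ((m₁ : ℝ) + m₂ * tau') ∈ Set.Ioc 0 1 ∨
    ((n₁ : ℝ) + n₂ * tau') + tau' ^ 2 * ((m₁ : ℝ) + m₂ * tau') ∈ Set.Ioc 0 1 := by
  obtain ⟨hx0, hx1⟩ := hn
  obtain ⟨hy0, hy1⟩ := hm
  generalize (n₁ : ℝ) + n₂ * tau' = x at *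
  generalize (m₁ : ℝ) + m₂ * tau' = y at *
  have hneg : tau' * y < 0 := mul_neg_of_neg_of_pos tau'_neg hy0
  rcases lt_or_ge 0 (x + tau' * y) with h | h
  · exact Or.inl ⟨h, by linarith⟩
  · refine Or.inr ⟨by positivity, ?_⟩
    rw [tau'_sq]
    linarith
end

section
/- For natural numbers a, b, c ≥ 1 and real numbers x, y, z such that x is compatible with grading a, y is compatible with grading b, and z is compatible with grading c, the two iterated graded sums agree and are compatible with grading a + b + c: x + (τ')ᵃ·(y + (τ')ᵇ·z) = (x + (τ')ᵃ·y) + (τ')^(a+b)·z, and this common value is compatible with grading a + b + c. In particular, the graded additive composition law on conjugates of points of Σ((0,1]) is associative. -/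
/-- A real number x is compatible with grading a ≥ 1 if x ∈ (0, 1 − 1/τᵃ]
when a is even, and x ∈ (1/τᵃ, 1] when a is odd. -/
def CompatibleGrading (a : ℕ) (x : ℝ) : Prop :=
  (Even a → x ∈ Set.Ioc 0 (1 - 1 / tau ^ a)) ∧ (Odd a → x ∈ Set.Ioc (1 / tau ^ a) 1)

theorem tau_pos : 0 < tau := by
  unfold tau
  positivity

theorem tau'_eq_neg_inv_tau : tau' = -(1 / tau) := by
  rw [eq_neg_iff_add_eq_zero]
  have h := tau_pos.ne'
  field_simp
  unfold tau tau'
  nlinarith [Real.sq_sqrt (show (0 : ℝ) ≤ 5 by norm_num)]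

/-- The graded sum of compatible numbers is compatible with the sum of the gradings. -/
theorem CompatibleGrading.graded_add {a b : ℕ} {x y : ℝ} (hx : CompatibleGrading a x)
    (hy : CompatibleGrading b y) : CompatibleGrading (a + b) (x + tau' ^ a * y) := by
  have hp : 0 < (1 / tau) ^ a := pow_pos (one_div_pos.mpr tau_pos) a
  simp only [CompatibleGrading, ← one_div_pow, Set.mem_Ioc] at *
  rw [tau'_eq_neg_inv_tau, pow_add]
  generalize (1 / tau) ^ b = q at *
  rcases Nat.even_or_odd a with ha | ha <;> rcases Nat.even_or_odd b with hb | hb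
  · obtain ⟨hx₁, hx₂⟩ := hx.1 ha
    obtain ⟨hy₁, hy₂⟩ := hy.1 hb
    rw [ha.neg_pow]
    refine ⟨fun _ => ⟨?_, ?_⟩, fun h => absurd h (Nat.not_odd_iff_even.mpr (ha.add hb))⟩ <;>
      nlinarith
  · obtain ⟨hx₁, hx₂⟩ := hx.1 ha
    obtain ⟨hy₁, hy₂⟩ := hy.2 hb
    rw [ha.neg_pow]
    refine ⟨fun h => absurd h (Nat.not_even_iff_odd.mpr (ha.add_odd hb)), fun _ => ⟨?_, ?_⟩⟩ <;>
      nlinarith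
  · obtain ⟨hx₁, hx₂⟩ := hx.2 ha
    obtain ⟨hy₁, hy₂⟩ := hy.1 hb
    rw [ha.neg_pow]
    refine ⟨fun h => absurd h (Nat.not_even_iff_odd.mpr (ha.add_even hb)), fun _ => ⟨?_, ?_⟩⟩ <;>
      nlinarith
  · obtain ⟨hx₁, hx₂⟩ := hx.2 ha
    obtain ⟨hy₁, hy₂⟩ := hy.2 hb
    rw [ha.neg_pow]
    refine ⟨fun _ => ⟨?_, ?_⟩, fun h => absurd h (Nat.not_odd_iff_even.mpr (ha.add_odd hb))⟩ <;>
      nlinarith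

/-- The graded additive composition law is associative and the iterated sum is
compatible with the sum of the gradings. -/
theorem stmt12_graded_sum_assoc (a b c : ℕ) (ha : 1 ≤ a) (hb : 1 ≤ b) (hc : 1 ≤ c)
    (x y z : ℝ) (hx : CompatibleGrading a x) (hy : CompatibleGrading b y)
    (hz : CompatibleGrading c z) :
    x + tau' ^ a * (y + tau' ^ b * z) = (x + tau' ^ a * y) + tau' ^ (a + b) * z ∧
    CompatibleGrading (a + b + c) (x + tau' ^ a * (y + tau' ^ b * z)) := by
  refine ⟨by ring, ?_⟩
  rw [add_assoc]
  exact hx.graded_add (hy.graded_add hz)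
end
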